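/- Let Y, Q, Z be random variables on a common probability space, each taking values in a finite nonempty set, and suppose they form a Markov chain Y ↔ Q ↔ Z (Y and Z are conditionally independent given Q). Then the absolute difference between the mutual information of Y with Z and the mutual information of Q with Z is bounded by the conditional entropy of Q given Y: |I(Y;Z) − I(Q;Z)| ≤ H(Q | Y). -/

import Mathlib

/-!
Statement 0: If finite random variables `Y ↔ Q ↔ Z` form a Markov chain
(Y and Z are conditionally independent given Q), then
`|I(Y;Z) − I(Q;Z)| ≤ H(Q | Y)`.

We model the joint law of `(Y, Q, Z)` by a joint probability mass function
`p : Y → Q → Z → ℝ` on finite nonempty types.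
-/

open scoped BigOperators

noncomputable section

variable {Y Q Z : Type*} [Fintype Y] [Fintype Q] [Fintype Z]

/-- Marginal pmf of `Y`. -/
def margY (p : Y → Q → Z → ℝ) (y : Y) : ℝ := ∑ q, ∑ z, p y q z

/-- Marginal pmf of `Q`. -/
def margQ (p : Y → Q → Z → ℝ) (q : Q) : ℝ := ∑ y, ∑ z, p y q z

/-- Marginal pmf of `Z`. -/
def margZ (p : Y → Q → Z → ℝ) (z : Z) : ℝ := ∑ y, ∑ q, p y q z

/-- Joint marginal pmf of `(Y, Q)`. -/
def margYQ (p : Y → Q → Z → ℝ) (y : Y) (q : Q) : ℝ := ∑ z, p y q z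

/-- Joint marginal pmf of `(Q, Z)`. -/
def margQZ (p : Y → Q → Z → ℝ) (q : Q) (z : Z) : ℝ := ∑ y, p y q z

/-- Joint marginal pmf of `(Y, Z)`. -/
def margYZ (p : Y → Q → Z → ℝ) (y : Y) (z : Z) : ℝ := ∑ q, p y q z

/-- Mutual information `I(Y;Z) = Σ_{y,z} p(y,z) log( p(y,z) / (p(y) p(z)) )`
(with the convention `0 · log 0 = 0`, which holds automatically since `Real.log 0 = 0`). -/
def miYZ (p : Y → Q → Z → ℝ) : ℝ :=
  ∑ y, ∑ z, margYZ p y z * Real.log (margYZ p y z / (margY p y * margZ p z))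

/-- Mutual information `I(Q;Z)`. -/
def miQZ (p : Y → Q → Z → ℝ) : ℝ :=
  ∑ q, ∑ z, margQZ p q z * Real.log (margQZ p q z / (margQ p q * margZ p z))

/-- Conditional entropy `H(Q|Y) = −Σ_{y,q} p(y,q) log p(q|y)`. -/
def condEntQgivenY (p : Y → Q → Z → ℝ) : ℝ :=
  -∑ y, ∑ q, margYQ p y q * Real.log (margYQ p y q / margY p y)

section

variable {p : Y → Q → Z → ℝ}

lemma margYQ_nonneg (hp : ∀ y q z, 0 ≤ p y q z) (y : Y) (q : Q) : 0 ≤ margYQ p y q :=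
  Finset.sum_nonneg fun z _ => hp y q z

lemma margYZ_nonneg (hp : ∀ y q z, 0 ≤ p y q z) (y : Y) (z : Z) : 0 ≤ margYZ p y z :=
  Finset.sum_nonneg fun q _ => hp y q z

lemma margY_nonneg (hp : ∀ y q z, 0 ≤ p y q z) (y : Y) : 0 ≤ margY p y :=
  Finset.sum_nonneg fun q _ => margYQ_nonneg hp y q

lemma le_margYQ (hp : ∀ y q z, 0 ≤ p y q z) (y : Y) (q : Q) (z : Z) :
    p y q z ≤ margYQ p y q :=
  Finset.single_le_sum (f := fun z => p y q z) (fun z _ => hp y q z) (Finset.mem_univ z)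

lemma le_margQZ (hp : ∀ y q z, 0 ≤ p y q z) (y : Y) (q : Q) (z : Z) :
    p y q z ≤ margQZ p q z :=
  Finset.single_le_sum (f := fun y => p y q z) (fun y _ => hp y q z) (Finset.mem_univ y)

lemma le_margYZ (hp : ∀ y q z, 0 ≤ p y q z) (y : Y) (q : Q) (z : Z) :
    p y q z ≤ margYZ p y z :=
  Finset.single_le_sum (f := fun q => p y q z) (fun q _ => hp y q z) (Finset.mem_univ q)

lemma margYQ_le_margY (hp : ∀ y q z, 0 ≤ p y q z) (y : Y) (q : Q) :
    margYQ p y q ≤ margY p y :=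
  Finset.single_le_sum (f := fun q => margYQ p y q) (fun q _ => margYQ_nonneg hp y q)
    (Finset.mem_univ q)

lemma margYQ_le_margQ (hp : ∀ y q z, 0 ≤ p y q z) (y : Y) (q : Q) :
    margYQ p y q ≤ margQ p q :=
  Finset.single_le_sum (f := fun y => margYQ p y q) (fun y _ => margYQ_nonneg hp y q)
    (Finset.mem_univ y)

lemma margYZ_le_margZ (hp : ∀ y q z, 0 ≤ p y q z) (y : Y) (z : Z) :
    margYZ p y z ≤ margZ p z :=
  Finset.single_le_sum (f := fun y => margYZ p y z) (fun y _ => margYZ_nonneg hp y z)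
    (Finset.mem_univ y)

lemma miYZ_eq_sum (p : Y → Q → Z → ℝ) :
    miYZ p = ∑ y, ∑ q, ∑ z,
      p y q z * Real.log (margYZ p y z / (margY p y * margZ p z)) := by
  unfold miYZ
  refine Finset.sum_congr rfl fun y _ => ?_
  rw [Finset.sum_comm]
  refine Finset.sum_congr rfl fun z _ => ?_
  rw [← Finset.sum_mul]
  rfl

lemma miQZ_eq_sum (p : Y → Q → Z → ℝ) :
    miQZ p = ∑ y, ∑ q, ∑ z,
      p y q z * Real.log (margQZ p q z / (margQ p q * margZ p z)) := by
  unfold miQZ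
  rw [Finset.sum_comm (s := (Finset.univ : Finset Y))]
  refine Finset.sum_congr rfl fun q _ => ?_
  rw [Finset.sum_comm (s := (Finset.univ : Finset Y))]
  refine Finset.sum_congr rfl fun z _ => ?_
  rw [← Finset.sum_mul]
  rfl

lemma condEntQgivenY_eq_sum (p : Y → Q → Z → ℝ) :
    condEntQgivenY p = -∑ y, ∑ q, ∑ z,
      p y q z * Real.log (margYQ p y q / margY p y) := by
  simp only [condEntQgivenY, ← Finset.sum_mul]
  rfl

lemma condEntQgivenY_nonneg (hp : ∀ y q z, 0 ≤ p y q z) : 0 ≤ condEntQgivenY p := by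
  refine neg_nonneg.2 (Finset.sum_nonpos fun y _ => Finset.sum_nonpos fun q _ => ?_)
  have hY := margY_nonneg hp y
  have hYQ := margYQ_nonneg hp y q
  exact mul_nonpos_of_nonneg_of_nonpos hYQ
    (Real.log_nonpos (by positivity) (div_le_one_of_le₀ (margYQ_le_margY hp y q) hY))

lemma sum_margYZ_mul_margYQ_div_margY (p : Y → Q → Z → ℝ) :
    ∑ y, ∑ q, ∑ z, margYZ p y z * margYQ p y q / margY p y = ∑ y, ∑ q, ∑ z, p y q z := by
  refine Finset.sum_congr rfl fun y _ => ?_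
  have hQ : ∑ q, margYQ p y q = margY p y := rfl
  have hZ : ∑ z, margYZ p y z = margY p y := Finset.sum_comm
  simp only [← Finset.sum_div, ← Finset.sum_mul, ← Finset.mul_sum, hQ, hZ]
  exact mul_self_div_self _

/-- The data processing inequality for `Y ↔ Q ↔ Z`. -/
lemma miYZ_le_miQZ_of_markov (hp : ∀ y q z, 0 ≤ p y q z)
    (hmarkov : ∀ q, 0 < margQ p q → ∀ y z,
      p y q z / margQ p q = (margYQ p y q / margQ p q) * (margQZ p q z / margQ p q)) :
    miYZ p ≤ miQZ p := by
  have key : ∀ y q z, p y q z * Real.log (margYZ p y z / (margY p y * margZ p z)) -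
      p y q z * Real.log (margQZ p q z / (margQ p q * margZ p z)) ≤
      margYZ p y z * margYQ p y q / margY p y - p y q z := by
    intro y q z
    rcases (hp y q z).eq_or_lt with h | h
    · have hY := margY_nonneg hp y
      have hYQ := margYQ_nonneg hp y q
      have hYZ := margYZ_nonneg hp y z
      rw [← h]
      simp only [zero_mul, sub_zero]
      positivity
    have hYQ := h.trans_le (le_margYQ hp y q z)
    have hYZ := h.trans_le (le_margYZ hp y q z)
    have hQZ := h.trans_le (le_margQZ hp y q z)
    have hY := hYQ.trans_le (margYQ_le_margY hp y q)
    have hQ := hYQ.trans_le (margYQ_le_margQ hp y q)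
    have hZ := hYZ.trans_le (margYZ_le_margZ hp y z)
    have hm := hmarkov q hQ y z
    have hm' : p y q z * margQ p q = margYQ p y q * margQZ p q z := by
      field_simp at hm
      linarith
    have hratio : margYZ p y z / (margY p y * margZ p z) /
        (margQZ p q z / (margQ p q * margZ p z)) =
        margYZ p y z * margYQ p y q / margY p y / p y q z := by
      field_simp
      linear_combination hm'
    rw [← mul_sub, ← Real.log_div (by positivity) (by positivity), hratio]
    calc _ ≤ p y q z * (margYZ p y z * margYQ p y q / margY p y / p y q z - 1) :=
          mul_le_mul_of_nonneg_left (Real.log_le_sub_one_of_pos (by positivity)) h.le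
      _ = _ := by field_simp
  have := Finset.sum_le_sum fun y (_ : y ∈ Finset.univ) =>
    Finset.sum_le_sum fun q (_ : q ∈ Finset.univ) =>
      Finset.sum_le_sum fun z (_ : z ∈ Finset.univ) => key y q z
  simp only [Finset.sum_sub_distrib] at this
  rw [sum_margYZ_mul_margYQ_div_margY, ← miYZ_eq_sum, ← miQZ_eq_sum] at this
  linarith

lemma miQZ_sub_miYZ_le_condEntQgivenY_of_markov (hp : ∀ y q z, 0 ≤ p y q z)
    (hmarkov : ∀ q, 0 < margQ p q → ∀ y z,
      p y q z / margQ p q = (margYQ p y q / margQ p q) * (margQZ p q z / margQ p q)) :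
    miQZ p - miYZ p ≤ condEntQgivenY p := by
  have key : ∀ y q z, p y q z * Real.log (margQZ p q z / (margQ p q * margZ p z)) -
      p y q z * Real.log (margYZ p y z / (margY p y * margZ p z)) ≤
      -(p y q z * Real.log (margYQ p y q / margY p y)) := by
    intro y q z
    rcases (hp y q z).eq_or_lt with h | h
    · simp [← h]
    have hYQ := h.trans_le (le_margYQ hp y q z)
    have hYZ := h.trans_le (le_margYZ hp y q z)
    have hQZ := h.trans_le (le_margQZ hp y q z)
    have hY := hYQ.trans_le (margYQ_le_margY hp y q)
    have hQ := hYQ.trans_le (margYQ_le_margQ hp y q)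
    have hZ := hYZ.trans_le (margYZ_le_margZ hp y z)
    have hm := hmarkov q hQ y z
    have hm' : p y q z * margQ p q = margYQ p y q * margQZ p q z := by
      field_simp at hm
      linarith
    rw [← mul_sub, ← mul_neg]
    refine mul_le_mul_of_nonneg_left ?_ h.le
    rw [← Real.log_div (by positivity) (by positivity), ← Real.log_inv]
    refine Real.log_le_log (by positivity) ?_
    have hratio : margQZ p q z / (margQ p q * margZ p z) /
        (margYZ p y z / (margY p y * margZ p z)) =
        (margYQ p y q / margY p y)⁻¹ * (p y q z / margYZ p y z) := by
      field_simp
      linear_combination -hm'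
    rw [hratio]
    exact mul_le_of_le_one_right (by positivity)
      (div_le_one_of_le₀ (le_margYZ hp y q z) hYZ.le)
  have := Finset.sum_le_sum fun y (_ : y ∈ Finset.univ) =>
    Finset.sum_le_sum fun q (_ : q ∈ Finset.univ) =>
      Finset.sum_le_sum fun z (_ : z ∈ Finset.univ) => key y q z
  simp only [Finset.sum_sub_distrib, Finset.sum_neg_distrib] at this
  rwa [← miYZ_eq_sum, ← miQZ_eq_sum, ← condEntQgivenY_eq_sum] at this

end

/-- If `Y ↔ Q ↔ Z` is a Markov chain, then
`|I(Y;Z) − I(Q;Z)| ≤ H(Q | Y)`. -/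
theorem abs_mi_diff_le_condEnt_of_markov
    [Nonempty Y] [Nonempty Q] [Nonempty Z]
    (p : Y → Q → Z → ℝ)
    (hp : ∀ y q z, 0 ≤ p y q z)
    (hsum : ∑ y, ∑ q, ∑ z, p y q z = 1)
    (hmarkov : ∀ q, 0 < margQ p q → ∀ y z,
      p y q z / margQ p q = (margYQ p y q / margQ p q) * (margQZ p q z / margQ p q)) :
    |miYZ p - miQZ p| ≤ condEntQgivenY p := by
  have h₁ := miYZ_le_miQZ_of_markov hp hmarkov
  have h₂ := miQZ_sub_miYZ_le_condEntQgivenY_of_markov hp hmarkov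
  have h₃ := condEntQgivenY_nonneg hp
  exact abs_le.2 ⟨by linarith, by linarith⟩
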